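/- Let (A, ·) be a finite-dimensional anti-flexible algebra over a field F of characteristic ≠ 2 and let r ∈ A⊗A be skew-symmetric (σr = −r) and nondegenerate (i.e., the induced linear map r : A* → A, ⟨r(u*), v*⟩ = ⟨r, u*⊗v*⟩, is an isomorphism). Define the bilinear form ω on A by ω(x, y) = ⟨r⁻¹(x), y⟩. Then r is a solution of the anti-flexible Yang–Baxter equation in (A, ·) if and only if ω(x·y, z) + ω(y·z, x) + ω(z·x, y) = 0 for all x, y, z ∈ A. -/

import Mathlib

open LinearMap Module TensorProduct

def IsAntiFlexible {F : Type*} [Field F] {A : Type*} [AddCommGroup A] [Module F A]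
    (m : A →ₗ[F] A →ₗ[F] A) : Prop :=
  ∀ x y z : A, m (m x y) z - m x (m y z) = m (m z y) x - m z (m y x)

variable {F : Type*} [Field F] {A : Type*} [AddCommGroup A] [Module F A]

noncomputable def mulMap (m : A →ₗ[F] A →ₗ[F] A) : A ⊗[F] A →ₗ[F] A :=
  TensorProduct.lift m

noncomputable def prod1213 (m : A →ₗ[F] A →ₗ[F] A) :
    (A ⊗[F] A) ⊗[F] (A ⊗[F] A) →ₗ[F] (A ⊗[F] A) ⊗[F] A :=
  (TensorProduct.assoc F A A A).symm.toLinearMap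
    ∘ₗ TensorProduct.map (mulMap m) LinearMap.id
    ∘ₗ (tensorTensorTensorComm F A A A A).toLinearMap

noncomputable def prod1323 (m : A →ₗ[F] A →ₗ[F] A) :
    (A ⊗[F] A) ⊗[F] (A ⊗[F] A) →ₗ[F] (A ⊗[F] A) ⊗[F] A :=
  TensorProduct.map LinearMap.id (mulMap m)
    ∘ₗ (tensorTensorTensorComm F A A A A).toLinearMap

noncomputable def prod2312 (m : A →ₗ[F] A →ₗ[F] A) :
    (A ⊗[F] A) ⊗[F] (A ⊗[F] A) →ₗ[F] (A ⊗[F] A) ⊗[F] A :=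
  TensorProduct.map
      (TensorProduct.map LinearMap.id (mulMap m) ∘ₗ (TensorProduct.assoc F A A A).toLinearMap)
      LinearMap.id
    ∘ₗ (TensorProduct.assoc F (A ⊗[F] A) A A).symm.toLinearMap
    ∘ₗ (tensorTensorTensorComm F A A A A).toLinearMap
    ∘ₗ (TensorProduct.comm F (A ⊗[F] A) (A ⊗[F] A)).toLinearMap

def IsAFYBESolution (m : A →ₗ[F] A →ₗ[F] A) (r : A ⊗[F] A) : Prop :=
  prod1213 m (r ⊗ₜ[F] r) - prod2312 m (r ⊗ₜ[F] r) + prod1323 m (r ⊗ₜ[F] r) = 0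

/-- An element `r ∈ A ⊗ A` regarded as a linear map `A* → A`:
`⟨r(u*), v*⟩ = ⟨r, u* ⊗ v*⟩`. -/
noncomputable def tensorToMap (r : A ⊗[F] A) : Dual F A →ₗ[F] A :=
  dualTensorHom F (Dual F A) A
    (TensorProduct.map (Module.Dual.eval F A) LinearMap.id r)

@[simp]
theorem tensorToMap_tmul (a b : A) (u : Dual F A) : tensorToMap (a ⊗ₜ[F] b) u = u a • b := by
  simp [tensorToMap]

@[simp]
theorem tensorToMap_zero : tensorToMap (0 : A ⊗[F] A) = 0 := by
  simp [tensorToMap]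

@[simp]
theorem tensorToMap_add (s t : A ⊗[F] A) :
    tensorToMap (s + t) = tensorToMap s + tensorToMap t := by
  simp [tensorToMap]

@[simp]
theorem tensorToMap_neg (s : A ⊗[F] A) : tensorToMap (-s) = -tensorToMap s := by
  simp [tensorToMap]

/-- The evaluation `a ⊗ b ⊗ c ↦ u a * v b * w c` of three functionals on a triple tensor. -/
noncomputable def tripleEval (u v w : Dual F A) : (A ⊗[F] A) ⊗[F] A →ₗ[F] F :=
  LinearMap.mul' F F ∘ₗ TensorProduct.map (LinearMap.mul' F F ∘ₗ TensorProduct.map u v) w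

@[simp]
theorem tripleEval_tmul (u v w : Dual F A) (a b c : A) :
    tripleEval u v w ((a ⊗ₜ[F] b) ⊗ₜ[F] c) = u a * v b * w c := by
  simp [tripleEval]

theorem eq_zero_iff_tripleEval [FiniteDimensional F A] (T : (A ⊗[F] A) ⊗[F] A) :
    T = 0 ↔ ∀ u v w : Dual F A, tripleEval u v w T = 0 := by
  refine ⟨fun h => by simp [h], fun h => ?_⟩
  let b := Module.finBasis F A
  let B := (b.tensorProduct b).tensorProduct b
  refine B.ext_elem fun ⟨⟨i, j⟩, k⟩ => ?_
  have hB : B.coord ((i, j), k) = tripleEval (b.coord i) (b.coord j) (b.coord k) := by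
    refine TensorProduct.ext_threefold fun x y z => ?_
    simp [B]
    ring
  simpa using (LinearMap.congr_fun hB T).trans (h _ _ _)

theorem tripleEval_prod1213 (m : A →ₗ[F] A →ₗ[F] A) (u v w : Dual F A) (s t : A ⊗[F] A) :
    tripleEval u v w (prod1213 m (s ⊗ₜ[F] t)) =
      u (m (tensorToMap (TensorProduct.comm F A A s) v)
        (tensorToMap (TensorProduct.comm F A A t) w)) := by
  induction s with
  | zero => simp
  | add s₁ s₂ h₁ h₂ => simp [TensorProduct.add_tmul, h₁, h₂]
  | tmul a b =>
    induction t with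
    | zero => simp
    | add t₁ t₂ h₁ h₂ => simp [TensorProduct.tmul_add, h₁, h₂]
    | tmul c d => simp [prod1213, mulMap]; ring

theorem tripleEval_prod2312 (m : A →ₗ[F] A →ₗ[F] A) (u v w : Dual F A) (s t : A ⊗[F] A) :
    tripleEval u v w (prod2312 m (s ⊗ₜ[F] t)) =
      v (m (tensorToMap (TensorProduct.comm F A A s) w) (tensorToMap t u)) := by
  induction s with
  | zero => simp
  | add s₁ s₂ h₁ h₂ => simp [TensorProduct.add_tmul, h₁, h₂]
  | tmul a b =>
    induction t with
    | zero => simp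
    | add t₁ t₂ h₁ h₂ => simp [TensorProduct.tmul_add, h₁, h₂]
    | tmul c d => simp [prod2312, mulMap]; ring

theorem tripleEval_prod1323 (m : A →ₗ[F] A →ₗ[F] A) (u v w : Dual F A) (s t : A ⊗[F] A) :
    tripleEval u v w (prod1323 m (s ⊗ₜ[F] t)) =
      w (m (tensorToMap s u) (tensorToMap t v)) := by
  induction s with
  | zero => simp
  | add s₁ s₂ h₁ h₂ => simp [TensorProduct.add_tmul, h₁, h₂]
  | tmul a b =>
    induction t with
    | zero => simp
    | add t₁ t₂ h₁ h₂ => simp [TensorProduct.tmul_add, h₁, h₂]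
    | tmul c d => simp [prod1323, mulMap]; ring

theorem apply_tensorToMap_comm (s : A ⊗[F] A) (u v : Dual F A) :
    v (tensorToMap (TensorProduct.comm F A A s) u) = u (tensorToMap s v) := by
  induction s with
  | zero => simp
  | add s₁ s₂ h₁ h₂ => simp [h₁, h₂]
  | tmul a b => simp [mul_comm]

/-- a skew-symmetric nondegenerate `r` is a solution of the
anti-flexible Yang–Baxter equation iff the bilinear form
`ω(x, y) = ⟨r⁻¹(x), y⟩` satisfies `ω(x·y, z) + ω(y·z, x) + ω(z·x, y) = 0`. -/
theorem afybe_iff_cyclic_form [FiniteDimensional F A]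
    (hchar : (2 : F) ≠ 0)
    (m : A →ₗ[F] A →ₗ[F] A) (hm : IsAntiFlexible m)
    (r : A ⊗[F] A) (hskew : TensorProduct.comm F A A r = -r)
    (e : Dual F A ≃ₗ[F] A) (he : e.toLinearMap = tensorToMap r) :
    IsAFYBESolution m r ↔
      ∀ x y z : A, e.symm (m x y) z + e.symm (m y z) x + e.symm (m z x) y = 0 := by
  have hT (u : Dual F A) : tensorToMap r u = e u := by rw [← he]; rfl
  have hskew_form (x y : A) : e.symm x y = -e.symm y x := by
    have h := apply_tensorToMap_comm r (e.symm x) (e.symm y)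
    simp only [hskew, tensorToMap_neg, LinearMap.neg_apply, hT, map_neg,
      LinearEquiv.apply_symm_apply] at h
    exact h.symm
  have hAFYBE : IsAFYBESolution m r ↔ ∀ u v w : Dual F A,
      u (m (e v) (e w)) + v (m (e w) (e u)) + w (m (e u) (e v)) = 0 := by
    rw [IsAFYBESolution, eq_zero_iff_tripleEval]
    simp [tripleEval_prod1213, tripleEval_prod2312, tripleEval_prod1323, hskew, hT]
  rw [hAFYBE]
  constructor
  · intro h x y z
    have h' := h (e.symm x) (e.symm y) (e.symm z)
    simp only [LinearEquiv.apply_symm_apply] at h'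
    rw [hskew_form (m x y), hskew_form (m y z), hskew_form (m z x)]
    linear_combination -h'
  · intro h u v w
    have h' := h (e u) (e v) (e w)
    rw [hskew_form (m (e u) (e v)), hskew_form (m (e v) (e w)), hskew_form (m (e w) (e u))] at h'
    simp only [LinearEquiv.symm_apply_apply] at h'
    linear_combination -h'
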